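/- arXiv:2009.01961 — 2 statements merged into one kernel-verified Lean document; each statement's English description precedes it below -/
import Mathlib

section
/- Let f be a Gaussian random field on ℝ with mean function m and covariance function k such that m is differentiable and k is twice continuously differentiable. Fix x ∈ ℝ and for δ ≠ 0 set ξ_δ = (f(x+δ) − f(x))/δ. Then E[ξ_δ ξ_τ] converges to ∂²k/∂x∂x'(x,x) + m'(x)² as (δ,τ) → (0,0) with δ, τ ≠ 0. -/
open MeasureTheory ProbabilityTheory Filter Topology
open scoped NNReal

/-- A real random variable has a (possibly degenerate) Gaussian distribution. -/
def IsGaussianRV {Ω : Type*} [MeasurableSpace Ω] (P : Measure Ω) (ξ : Ω → ℝ) : Prop :=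
  Measurable ξ ∧ ∃ (μ : ℝ) (v : ℝ≥0), Measure.map ξ P = gaussianReal μ v

/-- A Gaussian random field on a set `X`: every finite linear combination of its
values is a (possibly degenerate) Gaussian random variable. -/
def IsGaussianRF {Ω : Type*} [MeasurableSpace Ω] (P : Measure Ω) {X : Type*}
    (f : X → Ω → ℝ) : Prop :=
  (∀ x, Measurable (f x)) ∧
  ∀ (p : ℕ) (x : Fin p → X) (c : Fin p → ℝ),
    IsGaussianRV P (fun ω => ∑ i, c i * f (x i) ω)

/-- `Df` is the derivative random field of `f`: at every point, the difference
quotients of `f` converge to `Df` in mean square. -/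
def IsDerivField {Ω : Type*} [MeasurableSpace Ω] (P : Measure Ω)
    (f Df : ℝ → Ω → ℝ) : Prop :=
  (∀ x, Measurable (Df x)) ∧
  ∀ x : ℝ, Tendsto (fun δ : ℝ => ∫ ω, ((f (x + δ) ω - f x ω) / δ - Df x ω) ^ 2 ∂P)
    (𝓝[≠] 0) (𝓝 0)

/-- A real random variable with a (possibly degenerate) Gaussian distribution is
square-integrable. -/
theorem IsGaussianRV.memLp_two {Ω : Type*} [MeasurableSpace Ω] {P : Measure Ω} {ξ : Ω → ℝ}
    (h : IsGaussianRV P ξ) : MemLp ξ 2 P := by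
  obtain ⟨hξ, μ, v, hmap⟩ := h
  have hid : MemLp id 2 (Measure.map ξ P) := by
    rw [hmap]
    exact memLp_id_gaussianReal 2
  simpa using (memLp_map_measure_iff aestronglyMeasurable_id hξ.aemeasurable).1 hid

theorem IsGaussianRF.memLp_two {Ω : Type*} [MeasurableSpace Ω] {P : Measure Ω} {X : Type*}
    {f : X → Ω → ℝ} (hf : IsGaussianRF P f) (x : X) : MemLp (f x) 2 P := by
  simpa using (hf.2 1 (fun _ => x) (fun _ => 1)).memLp_two

/-- The mean value theorem with an increment of arbitrary sign. -/
theorem exists_sub_eq_mul_of_hasDerivAt {g g' : ℝ → ℝ} (hg : ∀ y, HasDerivAt g (g' y) y)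
    (x δ : ℝ) : ∃ θ ∈ Set.Ioo (0 : ℝ) 1, g (x + δ) - g x = g' (x + θ * δ) * δ := by
  have hline : ∀ t, HasDerivAt (fun t => g (x + t * δ)) (g' (x + t * δ) * δ) t := fun t => by
    have h := ((hasDerivAt_id t).mul_const δ).const_add x
    rw [one_mul] at h
    exact (hg (x + t * δ)).comp t h
  obtain ⟨θ, hθ, h⟩ := exists_hasDerivAt_eq_slope (fun t => g (x + t * δ)) _ one_pos
    (fun t _ => (hline t).continuousAt.continuousWithinAt) (fun t _ => hline t)
  exact ⟨θ, hθ, by simpa using h.symm⟩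

/-- The mixed second difference quotients of a `C²` function of two real variables converge
to its mixed second derivative. -/
theorem tendsto_mixed_second_difference_quotient {k : ℝ → ℝ → ℝ}
    (hk : ContDiff ℝ 2 (fun p : ℝ × ℝ => k p.1 p.2)) (x y : ℝ) :
    Tendsto (fun p : ℝ × ℝ =>
        (k (x + p.1) (y + p.2) - k x (y + p.2) - (k (x + p.1) y - k x y)) / (p.1 * p.2))
      ((𝓝[≠] (0 : ℝ)) ×ˢ (𝓝[≠] (0 : ℝ)))
      (𝓝 (deriv (fun v => deriv (fun u => k u v) x) y)) := by
  set G : ℝ × ℝ → ℝ := fun p => fderiv ℝ (fun p : ℝ × ℝ => k p.1 p.2) p (1, 0)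
  set H : ℝ × ℝ → ℝ := fun p => fderiv ℝ G p (0, 1)
  have hGc : ContDiff ℝ 1 G :=
    (hk.fderiv_right (m := 1) (by norm_num)).clm_apply contDiff_const
  have hHc : Continuous H :=
    (hGc.continuous_fderiv one_ne_zero).clm_apply continuous_const
  have hderiv_fst : ∀ u v, HasDerivAt (fun u => k u v) (G (u, v)) u := fun u v =>
    HasFDerivAt.comp_hasDerivAt (f := fun u => (u, v)) u
      (hk.differentiable two_ne_zero (u, v)).hasFDerivAt
      ((hasDerivAt_id u).prodMk (hasDerivAt_const u v))
  have hderiv_snd : ∀ u v, HasDerivAt (fun v => G (u, v)) (H (u, v)) v := fun u v =>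
    HasFDerivAt.comp_hasDerivAt (f := fun v => (u, v)) v
      (hGc.differentiable one_ne_zero (u, v)).hasFDerivAt
      ((hasDerivAt_const v u).prodMk (hasDerivAt_id v))
  have hlimit : deriv (fun v => deriv (fun u => k u v) x) y = H (x, y) := by
    simp_rw [fun v => (hderiv_fst x v).deriv]
    exact (hderiv_snd x y).deriv
  have hmvt : ∀ p : ℝ × ℝ, ∃ θ ∈ Set.Ioo (0 : ℝ) 1, ∃ φ ∈ Set.Ioo (0 : ℝ) 1,
      k (x + p.1) (y + p.2) - k x (y + p.2) - (k (x + p.1) y - k x y)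
        = H (x + θ * p.1, y + φ * p.2) * (p.1 * p.2) := by
    intro p
    obtain ⟨θ, hθ, h₁⟩ := exists_sub_eq_mul_of_hasDerivAt
      (fun u => (hderiv_fst u (y + p.2)).sub (hderiv_fst u y)) x p.1
    obtain ⟨φ, hφ, h₂⟩ := exists_sub_eq_mul_of_hasDerivAt (hderiv_snd (x + θ * p.1)) y p.2
    refine ⟨θ, hθ, φ, hφ, ?_⟩
    simp only [Pi.sub_apply] at h₁
    rw [h₂] at h₁
    linear_combination h₁
  choose θ hθ φ hφ hquot using hmvt
  have hscaled : ∀ {c t : ℝ × ℝ → ℝ}, (∀ p, c p ∈ Set.Ioo (0 : ℝ) 1) →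
      Tendsto t ((𝓝[≠] (0 : ℝ)) ×ˢ (𝓝[≠] (0 : ℝ))) (𝓝 0) →
      Tendsto (fun p => c p * t p) ((𝓝[≠] (0 : ℝ)) ×ˢ (𝓝[≠] (0 : ℝ))) (𝓝 0) := by
    intro c t hc ht
    refine squeeze_zero_norm (fun p => ?_) (tendsto_zero_iff_norm_tendsto_zero.1 ht)
    rw [norm_mul, Real.norm_of_nonneg (hc p).1.le]
    exact mul_le_of_le_one_left (norm_nonneg _) (hc p).2.le
  have hfst := hscaled hθ (tendsto_fst.mono_right nhdsWithin_le_nhds)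
  have hsnd := hscaled hφ (tendsto_snd.mono_right nhdsWithin_le_nhds)
  have hpt := (hfst.const_add x).prodMk_nhds (hsnd.const_add y)
  rw [add_zero, add_zero] at hpt
  rw [hlimit]
  refine ((hHc.tendsto (x, y)).comp hpt).congr' ?_
  filter_upwards [prod_mem_prod self_mem_nhdsWithin self_mem_nhdsWithin] with p hp
  have hne : p.1 * p.2 ≠ 0 := mul_ne_zero hp.1 hp.2
  rw [hquot, mul_div_cancel_right₀ _ hne]
  rfl

/-- For a Gaussian random field with differentiable mean and C² covariance, the second
moments of the difference quotients at `x` converge to `∂²k/∂x∂x'(x,x) + m'(x)²`. -/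
theorem statement1 {Ω : Type*} [MeasurableSpace Ω] (P : Measure Ω) [IsProbabilityMeasure P]
    (f : ℝ → Ω → ℝ) (m : ℝ → ℝ) (k : ℝ → ℝ → ℝ)
    (hf : IsGaussianRF P f)
    (hm : ∀ x, m x = ∫ ω, f x ω ∂P)
    (hk : ∀ x x', k x x' = ∫ ω, (f x ω - m x) * (f x' ω - m x') ∂P)
    (hmd : Differentiable ℝ m)
    (hkd : ContDiff ℝ 2 (fun p : ℝ × ℝ => k p.1 p.2))
    (x : ℝ) :
    Tendsto (fun dt : ℝ × ℝ =>
        ∫ ω, ((f (x + dt.1) ω - f x ω) / dt.1) * ((f (x + dt.2) ω - f x ω) / dt.2) ∂P)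
      ((𝓝[≠] (0:ℝ)) ×ˢ (𝓝[≠] (0:ℝ)))
      (𝓝 (deriv (fun y => deriv (fun u => k u y) x) x + (deriv m x) ^ 2)) := by
  have hL : ∀ y, MemLp (f y) 2 P := hf.memLp_two
  have hprod : ∀ y z, Integrable (fun ω => f y ω * f z ω) P := fun y z =>
    (hL y).integrable_mul (hL z)
  have hsub : ∀ u v y z, Integrable (fun ω => f u ω * f v ω - f y ω * f z ω) P :=
    fun u v y z => (hprod u v).sub (hprod y z)
  have hkm : ∀ y z, ∫ ω, f y ω * f z ω ∂P = k y z + m y * m z := by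
    intro y z
    have hcov := covariance_eq_sub (hL y) (hL z)
    rw [covariance, ← hm y, ← hm z, ← hk y z] at hcov
    simp only [Pi.mul_apply] at hcov
    linarith
  have hquot : ∀ δ τ : ℝ,
      ∫ ω, ((f (x + δ) ω - f x ω) / δ) * ((f (x + τ) ω - f x ω) / τ) ∂P
        = (k (x + δ) (x + τ) - k x (x + τ) - (k (x + δ) x - k x x)) / (δ * τ)
          + (m (x + δ) - m x) / δ * ((m (x + τ) - m x) / τ) := by
    intro δ τ
    have hexpand : ∀ ω, ((f (x + δ) ω - f x ω) / δ) * ((f (x + τ) ω - f x ω) / τ)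
        = (f (x + δ) ω * f (x + τ) ω - f x ω * f (x + τ) ω
          - (f (x + δ) ω * f x ω - f x ω * f x ω)) / (δ * τ) := fun ω => by
      rw [div_mul_div_comm]; ring
    simp_rw [hexpand]
    rw [integral_div, integral_sub (hsub _ _ _ _) (hsub _ _ _ _),
      integral_sub (hprod _ _) (hprod _ _), integral_sub (hprod _ _) (hprod _ _),
      hkm, hkm, hkm, hkm, div_mul_div_comm]
    ring
  have hslope : Tendsto (fun t => (m (x + t) - m x) / t) (𝓝[≠] 0) (𝓝 (deriv m x)) := by
    simpa [div_eq_inv_mul] using (hmd x).hasDerivAt.tendsto_slope_zero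
  simp_rw [hquot, sq]
  exact (tendsto_mixed_second_difference_quotient hkd x x).add
    ((hslope.comp tendsto_fst).mul (hslope.comp tendsto_snd))
end

section
/- Let f be a Gaussian random field on ℝ with mean function m and covariance function k such that m is differentiable and k is twice continuously differentiable. Fix x ∈ ℝ and for δ ≠ 0 set ξ_δ = (f(x+δ) − f(x))/δ. Then the family (ξ_δ) is Cauchy in L²(Ω) as δ → 0: E[|ξ_δ − ξ_τ|²] → 0 as (δ,τ) → (0,0) with δ, τ ≠ 0. -/
open MeasureTheory ProbabilityTheory Filter Topology
open scoped NNReal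

theorem IsGaussianRF.isGaussianRV {Ω : Type*} [MeasurableSpace Ω] {P : Measure Ω} {X : Type*}
    {f : X → Ω → ℝ} (hf : IsGaussianRF P f) (x : X) : IsGaussianRV P (f x) := by
  simpa using hf.2 1 (fun _ => x) (fun _ => 1)

/-- The mixed second difference quotients of a `C²` function of two variables converge
jointly to its mixed second derivative. -/
theorem ContDiff.exists_tendsto_mixed_slope {k : ℝ → ℝ → ℝ}
    (hk : ContDiff ℝ 2 (fun p : ℝ × ℝ => k p.1 p.2)) (x y : ℝ) :
    ∃ L : ℝ, Tendsto (fun p : ℝ × ℝ =>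
      (k (x + p.1) (y + p.2) - k (x + p.1) y - k x (y + p.2) + k x y) / (p.1 * p.2))
      (𝓝[≠] 0 ×ˢ 𝓝[≠] 0) (𝓝 L) := by
  set K : ℝ × ℝ → ℝ := fun p => k p.1 p.2
  set φ : ℝ × ℝ → ℝ := fun p => fderiv ℝ K p (1, 0)
  have hφ_C1 : ContDiff ℝ 1 φ := (hk.fderiv_right (by norm_num)).clm_apply contDiff_const
  have hKφ : ∀ s t, HasDerivAt (fun s => k s t) (φ (s, t)) s := fun s t =>
    (hk.differentiable (by norm_num) (s, t)).hasFDerivAt.comp_hasDerivAt (f := fun s => (s, t)) s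
      ((hasDerivAt_id s).prodMk (hasDerivAt_const s t))
  have hstrict : HasStrictFDerivAt φ (fderiv ℝ φ (x, y)) (x, y) :=
    hφ_C1.contDiffAt.hasStrictFDerivAt (by norm_num)
  set A := fderiv ℝ φ (x, y)
  refine ⟨A (0, 1), Metric.tendsto_nhds.2 fun ε hε => ?_⟩
  have hbound := hstrict.isLittleO.def (half_pos hε)
  obtain ⟨r, hr, hball⟩ := Metric.eventually_nhds_iff_ball.1 hbound
  have hsmall : ∀ᶠ δ : ℝ in 𝓝[≠] 0, δ ≠ 0 ∧ |δ| < r := by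
    refine eventually_mem_nhdsWithin.and (nhdsWithin_le_nhds ?_)
    filter_upwards [Metric.ball_mem_nhds (0 : ℝ) hr] with δ hδ
    simpa using hδ
  filter_upwards [hsmall.prod_mk hsmall] with ⟨δ, τ⟩ ⟨⟨hδ0, hδ⟩, hτ0, hτ⟩
  have hderiv : ∀ s ∈ Metric.ball x r,
      HasDerivWithinAt (fun s => k s (y + τ) - k s y - s * (τ * A (0, 1)))
        (φ (s, y + τ) - φ (s, y) - 1 * (τ * A (0, 1))) (Metric.ball x r) s := fun s _ =>
    (((hKφ s (y + τ)).sub (hKφ s y)).sub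
      ((hasDerivAt_id s).mul_const (τ * A (0, 1)))).hasDerivWithinAt
  have hle : ∀ s ∈ Metric.ball x r,
      ‖φ (s, y + τ) - φ (s, y) - 1 * (τ * A (0, 1))‖ ≤ ε / 2 * |τ| := by
    intro s hs
    have h := hball ((s, y + τ), (s, y)) (by
      simp only [Metric.mem_ball, Prod.dist_eq, max_lt_iff, Real.dist_eq] at hs ⊢
      simp [hs, hτ, hr])
    have hA : A (0, τ) = τ * A (0, 1) := by
      rw [← smul_eq_mul, ← map_smul]; simp
    simpa [hA, Prod.norm_def] using h
  have hmvt := (convex_ball x r).norm_image_sub_le_of_norm_hasDerivWithin_le hderiv hle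
    (Metric.mem_ball_self hr) (y := x + δ) (by simpa using hδ)
  have hpos : 0 < |δ * τ| := abs_pos.2 (mul_ne_zero hδ0 hτ0)
  rw [Real.dist_eq]
  have heq : (k (x + δ) (y + τ) - k (x + δ) y - k x (y + τ) + k x y) / (δ * τ) - A (0, 1) =
      (k (x + δ) (y + τ) - k (x + δ) y - (x + δ) * (τ * A (0, 1)) -
        (k x (y + τ) - k x y - x * (τ * A (0, 1)))) / (δ * τ) := by
    field_simp
    ring
  rw [heq, abs_div, div_lt_iff₀ hpos]
  rw [Real.norm_eq_abs, Real.norm_eq_abs, add_sub_cancel_left] at hmvt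
  calc _ ≤ ε / 2 * |τ| * |δ| := hmvt
    _ = ε / 2 * |δ * τ| := by rw [abs_mul]; ring
    _ < ε * |δ * τ| := by gcongr; linarith

/-- The second moments of the increments of a square-integrable field, in terms of its mean
and covariance functions. -/
theorem integral_sub_mul_sub_eq {Ω : Type*} [MeasurableSpace Ω] {P : Measure Ω}
    [IsProbabilityMeasure P] {X : Type*} {f : X → Ω → ℝ} {m : X → ℝ} {k : X → X → ℝ}
    (hf : ∀ x, MemLp (f x) 2 P) (hm : ∀ x, m x = ∫ ω, f x ω ∂P)
    (hk : ∀ x x', k x x' = ∫ ω, (f x ω - m x) * (f x' ω - m x') ∂P) (x y z : X) :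
    ∫ ω, (f y ω - f x ω) * (f z ω - f x ω) ∂P =
      (k y z - k y x - k x z + k x x) + (m y - m x) * (m z - m x) := by
  have hcov : ∀ u v, k u v = cov[f u, f v; P] := fun u v => by
    rw [hk, covariance, hm, hm]
  have h := covariance_eq_sub ((hf y).sub (hf x)) ((hf z).sub (hf x))
  rw [covariance_sub_left (hf y) (hf x) ((hf z).sub (hf x)),
    covariance_sub_right (hf y) (hf z) (hf x), covariance_sub_right (hf x) (hf z) (hf x)] at h
  simp only [← hcov, Pi.sub_apply, Pi.mul_apply] at h
  rw [integral_sub ((hf y).integrable one_le_two) ((hf x).integrable one_le_two),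
    integral_sub ((hf z).integrable one_le_two) ((hf x).integrable one_le_two),
    ← hm, ← hm, ← hm] at h
  linarith

/-- A family in `L²` whose inner products converge along a product filter is Cauchy. -/
theorem tendsto_integral_sub_sq {Ω ι : Type*} [MeasurableSpace Ω] {P : Measure Ω}
    {ξ : ι → Ω → ℝ} {l : Filter ι} {L : ℝ} (hξ : ∀ i, MemLp (ξ i) 2 P)
    (h : Tendsto (fun p : ι × ι => ∫ ω, ξ p.1 ω * ξ p.2 ω ∂P) (l ×ˢ l) (𝓝 L)) :
    Tendsto (fun p : ι × ι => ∫ ω, (ξ p.1 ω - ξ p.2 ω) ^ 2 ∂P) (l ×ˢ l) (𝓝 0) := by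
  have hint : ∀ i j, Integrable (fun ω => ξ i ω * ξ j ω) P := fun i j =>
    (hξ i).integrable_mul (hξ j)
  have hexp : ∀ p : ι × ι, ∫ ω, (ξ p.1 ω - ξ p.2 ω) ^ 2 ∂P =
      ∫ ω, ξ p.1 ω * ξ p.1 ω ∂P - 2 * ∫ ω, ξ p.1 ω * ξ p.2 ω ∂P +
        ∫ ω, ξ p.2 ω * ξ p.2 ω ∂P := fun p => by
    have hpoly : ∀ ω, (ξ p.1 ω - ξ p.2 ω) ^ 2 =
        ξ p.1 ω * ξ p.1 ω - 2 * (ξ p.1 ω * ξ p.2 ω) + ξ p.2 ω * ξ p.2 ω := fun ω => by ring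
    simp only [hpoly]
    rw [integral_add _ (hint _ _), integral_sub (hint _ _) ((hint _ _).const_mul 2),
      integral_const_mul]
    exact (hint _ _).sub ((hint _ _).const_mul 2)
  simp only [hexp]
  have h1 := h.comp (tendsto_fst.prodMk (tendsto_fst (f := l) (g := l)))
  have h2 := h.comp (tendsto_snd.prodMk (tendsto_snd (f := l) (g := l)))
  have hlim := (h1.sub (h.const_mul 2)).add h2
  rwa [show L - 2 * L + L = 0 by ring] at hlim

/-- For a Gaussian random field with differentiable mean and C² covariance, the
difference quotients at `x` form a Cauchy family in L² as `δ → 0`. -/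
theorem statement2 {Ω : Type*} [MeasurableSpace Ω] (P : Measure Ω) [IsProbabilityMeasure P]
    (f : ℝ → Ω → ℝ) (m : ℝ → ℝ) (k : ℝ → ℝ → ℝ)
    (hf : IsGaussianRF P f)
    (hm : ∀ x, m x = ∫ ω, f x ω ∂P)
    (hk : ∀ x x', k x x' = ∫ ω, (f x ω - m x) * (f x' ω - m x') ∂P)
    (hmd : Differentiable ℝ m)
    (hkd : ContDiff ℝ 2 (fun p : ℝ × ℝ => k p.1 p.2))
    (x : ℝ) :
    Tendsto (fun dt : ℝ × ℝ =>
        ∫ ω, ((f (x + dt.1) ω - f x ω) / dt.1 - (f (x + dt.2) ω - f x ω) / dt.2) ^ 2 ∂P)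
      ((𝓝[≠] (0:ℝ)) ×ˢ (𝓝[≠] (0:ℝ))) (𝓝 0) := by
  have hL2 : ∀ y, MemLp (f y) 2 P := fun y => (hf.isGaussianRV y).memLp_two
  obtain ⟨L, hL⟩ := hkd.exists_tendsto_mixed_slope x x
  have hq := hasDerivAt_iff_tendsto_slope_zero.1 (hmd x).hasDerivAt
  have hlim := hL.add ((hq.comp tendsto_fst).mul (hq.comp tendsto_snd))
  refine tendsto_integral_sub_sq (ξ := fun δ ω => (f (x + δ) ω - f x ω) / δ)
    (fun δ => by
      simpa only [div_eq_mul_inv, Pi.sub_apply] using ((hL2 (x + δ)).sub (hL2 x)).mul_const δ⁻¹)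
    (hlim.congr fun p => ?_)
  simp only [div_mul_div_comm, integral_div, integral_sub_mul_sub_eq hL2 hm hk,
    Function.comp_apply, smul_eq_mul]
  ring
end
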